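/- arXiv:1406.6712 — 2 statements merged into one kernel-verified Lean document; each statement's English description precedes it below -/
import Mathlib

section
/- Let 0 < q ≤ 2 and set r = min{1, q}. Let N, m, s be positive integers, let δ ∈ (0, 1), and let 𝒜 : M_N → ℝ^m be a linear map such that (1 − δ)‖Z‖_{S_2}² ≤ ‖𝒜Z‖_{ℓ2}² ≤ (1 + δ)‖Z‖_{S_2}² for every Z ∈ M_N with rank(Z) ≤ 2s. Then every Z in the kernel of 𝒜 satisfies ‖Z‖_{S_q} ≤ 2^{1/r} · ((1 + δ)/(1 − δ))^{1/2} · s^{−(1/r − 1/q)} · ‖Z‖_{S_r}. -/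
noncomputable def singVals {N : ℕ} (X : Matrix (Fin N) (Fin N) ℝ) : Fin N → ℝ :=
  fun i => Real.sqrt ((Matrix.isHermitian_conjTranspose_mul_self X).eigenvalues i)

/-- The Schatten `p`-quasi-norm of a real `N × N` matrix. -/
noncomputable def schattenNorm {N : ℕ} (p : ℝ) (X : Matrix (Fin N) (Fin N) ℝ) : ℝ :=
  (∑ i, singVals X i ^ p) ^ (1 / p)

open Finset in
/-- If `f` sums to zero and is a restricted near-isometry with respect to the antitone weights `σ`,
then the leading `s` weights are controlled in `ℓ²` by the `ℓ¹` norm of all weights. -/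
theorem sum_sq_le_of_restricted_isometry {E : Type*} [NormedAddCommGroup E]
    {s M : ℕ} {δ : ℝ} (hs : 0 < s) (hδ0 : 0 < δ) (hδ1 : δ < 1)
    {σ : ℕ → ℝ} (hσ : Antitone σ) (hσ0 : ∀ i, 0 ≤ σ i) {f : ℕ → E}
    (hf : ∀ T : Finset ℕ, #T ≤ 2 * s →
      (1 - δ) * ∑ i ∈ T, σ i ^ 2 ≤ ‖∑ i ∈ T, f i‖ ^ 2 ∧
      ‖∑ i ∈ T, f i‖ ^ 2 ≤ (1 + δ) * ∑ i ∈ T, σ i ^ 2)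
    (hsum : ∑ i ∈ range ((M + 2) * s), f i = 0) :
    s * ∑ i ∈ range s, σ i ^ 2 ≤
      (1 + δ) / (1 - δ) * (∑ i ∈ range ((M + 2) * s), σ i) ^ 2 := by
  have hs' : (0 : ℝ) < s := by exact_mod_cast hs
  have hblock (n : ℕ) : √s * ‖∑ i ∈ Ico (n + s) (n + s + s), f i‖ ≤
      √(1 + δ) * ∑ i ∈ Ico n (n + s), σ i := by
    have hlow : s * σ (n + s) ≤ ∑ i ∈ Ico n (n + s), σ i := by
      simpa using card_nsmul_le_sum (Ico n (n + s)) σ (σ (n + s))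
        (fun i hi => hσ (mem_Ico.1 hi).2.le)
    have hup : ∑ i ∈ Ico (n + s) (n + s + s), σ i ^ 2 ≤ s * σ (n + s) ^ 2 := by
      simpa using sum_le_card_nsmul (Ico (n + s) (n + s + s)) (fun i => σ i ^ 2) (σ (n + s) ^ 2)
        (fun i hi => pow_le_pow_left₀ (hσ0 i) (hσ (mem_Ico.1 hi).1) 2)
    have hnorm := (hf (Ico (n + s) (n + s + s)) (by simp; omega)).2
    have hS : 0 ≤ ∑ i ∈ Ico n (n + s), σ i := sum_nonneg fun i _ => hσ0 i
    refine le_of_sq_le_sq ?_ (by positivity)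
    rw [mul_pow, mul_pow, Real.sq_sqrt hs'.le, Real.sq_sqrt (by linarith)]
    calc (s : ℝ) * ‖∑ i ∈ Ico (n + s) (n + s + s), f i‖ ^ 2
        ≤ s * ((1 + δ) * (s * σ (n + s) ^ 2)) := by
          gcongr
          exact hnorm.trans (by gcongr)
      _ = (1 + δ) * (s * σ (n + s)) ^ 2 := by ring
      _ ≤ _ := by
          have := hσ0 (n + s)
          gcongr
  have htail (k : ℕ) : √s * ‖∑ i ∈ Ico (2 * s) ((k + 2) * s), f i‖ ≤
      √(1 + δ) * ∑ i ∈ range ((k + 1) * s), σ i := by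
    induction k with
    | zero =>
      have : 0 ≤ ∑ i ∈ range ((0 + 1) * s), σ i := sum_nonneg fun i _ => hσ0 i
      simpa using mul_nonneg (Real.sqrt_nonneg _) (by simpa using this)
    | succ k ih =>
      have h := hblock ((k + 1) * s)
      rw [← sum_Ico_consecutive f (show 2 * s ≤ (k + 2) * s by gcongr; omega)
          (show (k + 2) * s ≤ (k + 1 + 2) * s by gcongr; omega),
        range_eq_Ico, ← sum_Ico_consecutive σ (show 0 ≤ (k + 1) * s by omega)
          (show (k + 1) * s ≤ (k + 1 + 1) * s by gcongr; omega), ← range_eq_Ico]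
      rw [show (k + 1) * s + s = (k + 2) * s by ring,
        show (k + 2) * s + s = (k + 1 + 2) * s by ring] at h
      calc _ ≤ √s * (‖∑ i ∈ Ico (2 * s) ((k + 2) * s), f i‖ +
            ‖∑ i ∈ Ico ((k + 2) * s) ((k + 1 + 2) * s), f i‖) := by
            gcongr; exact norm_add_le _ _
        _ ≤ _ := by rw [mul_add, mul_add]; exact add_le_add ih h
  have hS : 0 ≤ ∑ i ∈ range ((M + 2) * s), σ i := sum_nonneg fun i _ => hσ0 i
  have hhead : √s * ‖∑ i ∈ range (2 * s), f i‖ ≤ √(1 + δ) * ∑ i ∈ range ((M + 2) * s), σ i := by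
    rw [range_eq_Ico, ← sum_Ico_consecutive f (Nat.zero_le (2 * s))
      (show 2 * s ≤ (M + 2) * s by gcongr; omega), ← range_eq_Ico] at hsum
    rw [eq_neg_of_add_eq_zero_left hsum, norm_neg]
    refine (htail M).trans ?_
    gcongr
    · intro i _ _
      exact hσ0 i
    · omega
  have hsq := pow_le_pow_left₀ (by positivity) hhead 2
  rw [mul_pow, mul_pow, Real.sq_sqrt hs'.le, Real.sq_sqrt (by linarith)] at hsq
  have hlow := (hf (range (2 * s)) (by simp)).1
  have hmono : ∑ i ∈ range s, σ i ^ 2 ≤ ∑ i ∈ range (2 * s), σ i ^ 2 :=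
    sum_le_sum_of_subset_of_nonneg (range_subset_range.2 (by omega)) fun i _ _ => sq_nonneg _
  rw [div_mul_eq_mul_div, le_div_iff₀ (by linarith)]
  calc _ = s * ((1 - δ) * ∑ i ∈ range s, σ i ^ 2) := by ring
    _ ≤ s * ((1 - δ) * ∑ i ∈ range (2 * s), σ i ^ 2) := by
        have : 0 ≤ 1 - δ := by linarith
        gcongr
    _ ≤ s * ‖∑ i ∈ range (2 * s), f i‖ ^ 2 := by gcongr
    _ ≤ _ := hsq

open Finset in
/-- An `ℓ^q` bound for an antitone sequence whose leading `s` terms are controlled in `ℓ²`. -/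
theorem sum_rpow_le_of_sum_sq_le {s n : ℕ} {q C : ℝ} (hs : 0 < s) (hsn : s ≤ n)
    (hq1 : 1 ≤ q) (hq2 : q ≤ 2) (hC : 1 ≤ C)
    {σ : ℕ → ℝ} (hσ : Antitone σ) (hσ0 : ∀ i, 0 ≤ σ i)
    (h : s * ∑ i ∈ range s, σ i ^ 2 ≤ (C * ∑ i ∈ range n, σ i) ^ 2) :
    (∑ i ∈ range n, σ i ^ q) ^ (1 / q) ≤
      2 * C * (s : ℝ) ^ (-(1 - 1 / q)) * ∑ i ∈ range n, σ i := by
  have hs' : (0 : ℝ) < s := by exact_mod_cast hs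
  have hq0 : 0 < q := by linarith
  set S := ∑ i ∈ range n, σ i with hSdef
  have hS : 0 ≤ S := sum_nonneg fun i _ => hσ0 i
  set K := C * S / s with hK
  have hK0 : 0 ≤ K := by positivity
  have hLK : S / s ≤ K := by
    rw [hK]
    gcongr
    nlinarith
  have hsq : ∑ i ∈ range s, σ i ^ 2 ≤ s * K ^ 2 := by
    rw [hK, div_pow, ← mul_le_mul_iff_right₀ hs']
    refine h.trans_eq ?_
    field_simp
  have hhead : ∑ i ∈ range s, σ i ^ q ≤ s * K ^ q := by
    have hp : 0 < 2 / q := by positivity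
    rw [← Real.rpow_le_rpow_iff (sum_nonneg fun i _ => Real.rpow_nonneg (hσ0 i) q)
      (by positivity) hp]
    have hpow (x : ℝ) (hx : 0 ≤ x) : (x ^ q) ^ (2 / q) = x ^ 2 := by
      rw [← Real.rpow_mul hx, mul_div_cancel₀ _ hq0.ne', Real.rpow_two]
    calc _ ≤ (s : ℝ) ^ (2 / q - 1) * ∑ i ∈ range s, (σ i ^ q) ^ (2 / q) := by
          simpa using Real.rpow_sum_le_const_mul_sum_rpow_of_nonneg (s := range s)
            (f := fun i => σ i ^ q) (p := 2 / q) ((one_le_div hq0).2 hq2)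
            (fun i _ => Real.rpow_nonneg (hσ0 i) q)
      _ = (s : ℝ) ^ (2 / q - 1) * ∑ i ∈ range s, σ i ^ 2 := by
          congr 1
          exact sum_congr rfl fun i _ => hpow _ (hσ0 i)
      _ ≤ (s : ℝ) ^ (2 / q - 1) * (s * K ^ 2) := by gcongr
      _ = _ := by
          rw [Real.mul_rpow hs'.le (by positivity), hpow K hK0, Real.rpow_sub_one hs'.ne']
          field_simp
  have htail : ∑ i ∈ Ico s n, σ i ^ q ≤ s * K ^ q := by
    have hle (i : ℕ) (hi : s ≤ i) : σ i ≤ S / s := by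
      rw [le_div_iff₀ hs', mul_comm]
      calc (s : ℝ) * σ i ≤ ∑ j ∈ range s, σ j := by
            simpa using card_nsmul_le_sum (range s) σ (σ i)
              (fun j hj => hσ ((mem_range.1 hj).le.trans hi))
        _ ≤ S := sum_le_sum_of_subset_of_nonneg (range_subset_range.2 hsn) fun i _ _ => hσ0 i
    have hsplit (x : ℝ) (hx : 0 ≤ x) : x * x ^ (q - 1) = x ^ q := by
      rw [← Real.rpow_one_add' hx (by linarith), add_sub_cancel]
    calc _ ≤ ∑ i ∈ Ico s n, σ i * (S / s) ^ (q - 1) := by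
          refine sum_le_sum fun i hi => ?_
          rw [← hsplit _ (hσ0 i)]
          exact mul_le_mul_of_nonneg_left
            (Real.rpow_le_rpow (hσ0 i) (hle i (mem_Ico.1 hi).1) (by linarith)) (hσ0 i)
      _ ≤ S * (S / s) ^ (q - 1) := by
          rw [← sum_mul]
          gcongr
          rw [hSdef, range_eq_Ico]
          exact sum_le_sum_of_subset_of_nonneg (Ico_subset_Ico_left (Nat.zero_le s))
            fun i _ _ => hσ0 i
      _ = s * (S / s) ^ q := by
          rw [← hsplit (S / s) (by positivity)]
          field_simp
      _ ≤ _ := by gcongr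
  have htotal : ∑ i ∈ range n, σ i ^ q ≤ s * (2 * K) ^ q := by
    rw [← sum_range_add_sum_Ico _ hsn, Real.mul_rpow zero_le_two hK0]
    have h2 : (2 : ℝ) ≤ 2 ^ q := Real.self_le_rpow_of_one_le one_le_two hq1
    have : 2 * (s * K ^ q) ≤ 2 ^ q * (s * K ^ q) := by gcongr
    linarith
  calc _ ≤ ((s : ℝ) * (2 * K) ^ q) ^ (1 / q) := by
        gcongr
        exact sum_nonneg fun i _ => Real.rpow_nonneg (hσ0 i) q
    _ = (s : ℝ) ^ (1 / q) * (2 * K) := by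
        rw [Real.mul_rpow hs'.le (by positivity), ← Real.rpow_mul (by positivity),
          mul_one_div_cancel hq0.ne', Real.rpow_one]
    _ = _ := by
        rw [neg_sub, Real.rpow_sub_one hs'.ne', hK]
        field_simp

open Matrix in
theorem schattenNorm_two_sq {N : ℕ} (X : Matrix (Fin N) (Fin N) ℝ) :
    schattenNorm 2 X ^ 2 = (Xᴴ * X).trace := by
  have hX := isHermitian_conjTranspose_mul_self X
  have hnn (i : Fin N) : 0 ≤ hX.eigenvalues i := eigenvalues_conjTranspose_mul_self_nonneg X i
  have hsum : ∑ i, singVals X i ^ (2 : ℝ) = ∑ i, hX.eigenvalues i :=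
    Finset.sum_congr rfl fun i _ => by rw [Real.rpow_two, singVals, Real.sq_sqrt (hnn i)]
  rw [schattenNorm, hsum, ← Real.sqrt_eq_rpow, Real.sq_sqrt (Finset.sum_nonneg fun i _ => hnn i),
    hX.trace_eq_sum_eigenvalues]
  rfl

open Matrix Finset in
/-- The singular value decomposition of `Z`, as a sum of pairwise orthogonal matrices of rank at
most one. -/
theorem exists_singVals_decomposition {N : ℕ} (Z : Matrix (Fin N) (Fin N) ℝ) :
    ∃ W : Fin N → Matrix (Fin N) (Fin N) ℝ, ∑ i, W i = Z ∧
      ∀ T : Finset (Fin N), (∑ i ∈ T, W i).rank ≤ #T ∧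
        schattenNorm 2 (∑ i ∈ T, W i) ^ 2 = ∑ i ∈ T, singVals Z i ^ 2 := by
  have hZ := isHermitian_conjTranspose_mul_self Z
  set V : Matrix (Fin N) (Fin N) ℝ := hZ.eigenvectorUnitary.1
  have hVV : Vᴴ * V = 1 := Unitary.coe_star_mul_self hZ.eigenvectorUnitary
  have hVV' : V * Vᴴ = 1 := Unitary.coe_mul_star_self hZ.eigenvectorUnitary
  have hdiag : Vᴴ * (Zᴴ * Z) * V = diagonal hZ.eigenvalues := by
    have h := hZ.conjStarAlgAut_star_eigenvectorUnitary
    rwa [Unitary.conjStarAlgAut_star_apply] at h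
  have hW (T : Finset (Fin N)) : ∑ i ∈ T, Z * V * diagonal (Pi.single i 1) * Vᴴ =
      Z * V * diagonal (fun j => if j ∈ T then 1 else 0) * Vᴴ := by
    rw [← Matrix.sum_mul, ← Matrix.mul_sum]
    congr 2
    ext a b
    rw [Matrix.sum_apply]
    by_cases hab : a = b
    · subst hab
      simp [Pi.single_apply]
    · simp [hab]
  refine ⟨fun i => Z * V * diagonal (Pi.single i 1) * Vᴴ, ?_, fun T => ⟨?_, ?_⟩⟩
  · rw [hW]
    simp only [mem_univ, if_true, diagonal_one, Matrix.mul_one, Matrix.mul_assoc, hVV']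
  · rw [hW]
    refine (rank_mul_le_left _ _).trans ((rank_mul_le_right _ _).trans ?_)
    rw [rank_diagonal]
    simp
  · rw [hW, schattenNorm_two_sq]
    set D : Matrix (Fin N) (Fin N) ℝ := diagonal (fun j => if j ∈ T then 1 else 0) with hD
    have hDH : Dᴴ = D := by simp [hD]
    have hgram : (Z * V * D * Vᴴ)ᴴ * (Z * V * D * Vᴴ) =
        V * (D * diagonal hZ.eigenvalues * D * Vᴴ) := by
      simp only [conjTranspose_mul, conjTranspose_conjTranspose, hDH, ← hdiag, Matrix.mul_assoc]
    rw [hgram, trace_mul_comm, Matrix.mul_assoc, hVV, Matrix.mul_one, hD, diagonal_mul_diagonal,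
      diagonal_mul_diagonal, trace_diagonal]
    have hsq (i : Fin N) : singVals Z i ^ 2 = hZ.eigenvalues i :=
      Real.sq_sqrt (eigenvalues_conjTranspose_mul_self_nonneg Z i)
    simp [hsq]

/-- If `𝒜` satisfies the rank-`2s` Restricted Isometry Property with constant `δ`, then
every `Z` in the kernel of `𝒜` satisfies
`‖Z‖_{S_q} ≤ 2^{1/r} ((1+δ)/(1-δ))^{1/2} s^{-(1/r - 1/q)} ‖Z‖_{S_r}` with `r = min{1, q}`. -/
theorem kernel_bound_of_RIP (q : ℝ) (hq0 : 0 < q) (hq2 : q ≤ 2)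
    (N m s : ℕ) (hN : 0 < N) (hm : 0 < m) (hs : 0 < s)
    (δ : ℝ) (hδ0 : 0 < δ) (hδ1 : δ < 1)
    (A : Matrix (Fin N) (Fin N) ℝ →ₗ[ℝ] EuclideanSpace ℝ (Fin m))
    (hRIP : ∀ Z : Matrix (Fin N) (Fin N) ℝ, Z.rank ≤ 2 * s →
      (1 - δ) * schattenNorm 2 Z ^ 2 ≤ ‖A Z‖ ^ 2 ∧
      ‖A Z‖ ^ 2 ≤ (1 + δ) * schattenNorm 2 Z ^ 2)
    (Z : Matrix (Fin N) (Fin N) ℝ) (hZ : A Z = 0) :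
    schattenNorm q Z ≤
      (2 : ℝ) ^ (1 / min 1 q) * ((1 + δ) / (1 - δ)) ^ ((1 : ℝ) / 2) *
        (s : ℝ) ^ (-(1 / min 1 q - 1 / q)) * schattenNorm (min 1 q) Z := by
  have hnn (i : Fin N) : 0 ≤ singVals Z i := Real.sqrt_nonneg _
  have hratio : 1 ≤ (1 + δ) / (1 - δ) := (one_le_div (by linarith)).2 (by linarith)
  have hC : 1 ≤ ((1 + δ) / (1 - δ)) ^ ((1 : ℝ) / 2) := Real.one_le_rpow hratio (by norm_num)
  rcases le_total q 1 with hq1 | hq1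
  · rw [min_eq_right hq1, sub_self, neg_zero, Real.rpow_zero, mul_one]
    refine le_mul_of_one_le_left (Real.rpow_nonneg
      (Finset.sum_nonneg fun i _ => Real.rpow_nonneg (hnn i) q) _) ?_
    exact one_le_mul_of_one_le_of_one_le (Real.one_le_rpow one_le_two (by positivity)) hC
  rw [min_eq_left hq1]
  obtain ⟨W, hWsum, hW⟩ := exists_singVals_decomposition Z
  -- position of each index in the decreasing rearrangement of the singular values
  set e : Equiv.Perm (Fin N) := Tuple.sort fun i => -singVals Z i
  have hanti : Antitone (singVals Z ∘ e) := fun i j hij =>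
    neg_le_neg_iff.1 (Tuple.monotone_sort (fun i => -singVals Z i) hij)
  let pos : Fin N → ℕ := fun i => (e.symm i : ℕ)
  have hpos : Function.Injective pos := Fin.val_injective.comp e.symm.injective
  have hrange (k : ℕ) (hk : k < N) : pos (e ⟨k, hk⟩) = k := by simp [pos]
  set σ : ℕ → ℝ := Function.extend pos (singVals Z) 0
  set f : ℕ → EuclideanSpace ℝ (Fin m) := Function.extend pos (fun i => A (W i)) 0
  have hσpos (i : Fin N) : σ (pos i) = singVals Z i := hpos.extend_apply _ _ i
  have hfpos (i : Fin N) : f (pos i) = A (W i) := hpos.extend_apply _ _ i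
  have hσout (k : ℕ) (hk : k ∉ Set.range pos) : σ k = 0 := Function.extend_apply' _ _ _ hk
  have hfout (k : ℕ) (hk : k ∉ Set.range pos) : f k = 0 := Function.extend_apply' _ _ _ hk
  have hnotin (k : ℕ) (hk : ¬ k < N) : k ∉ Set.range pos := by
    rintro ⟨i, rfl⟩
    exact hk (e.symm i).isLt
  have hσ0 (k : ℕ) : 0 ≤ σ k := by
    by_cases hk : k ∈ Set.range pos
    · obtain ⟨i, rfl⟩ := hk
      rw [hσpos]
      exact hnn i
    · rw [hσout k hk]
  have hσanti : Antitone σ := by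
    intro k l hkl
    by_cases hl : l < N
    · have hk := hkl.trans_lt hl
      rw [← hrange k hk, ← hrange l hl, hσpos, hσpos]
      exact hanti hkl
    · rw [hσout l (hnotin l hl)]
      exact hσ0 k
  have hNle : N ≤ (N + 2) * s := by nlinarith
  have hpre : (Finset.range ((N + 2) * s)).preimage pos hpos.injOn = Finset.univ := by
    ext i
    simpa using (e.symm i).isLt.trans_le hNle
  have hsumσ (p : ℝ) (hp : p ≠ 0) :
      ∑ k ∈ Finset.range ((N + 2) * s), σ k ^ p = ∑ i, singVals Z i ^ p := by
    rw [← Finset.sum_preimage pos _ hpos.injOn (fun k => σ k ^ p)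
      (fun k _ hk => by rw [hσout k hk, Real.zero_rpow hp]), hpre]
    simp only [hσpos]
  have hf (T : Finset ℕ) (hT : T.card ≤ 2 * s) :
      (1 - δ) * ∑ i ∈ T, σ i ^ 2 ≤ ‖∑ i ∈ T, f i‖ ^ 2 ∧
      ‖∑ i ∈ T, f i‖ ^ 2 ≤ (1 + δ) * ∑ i ∈ T, σ i ^ 2 := by
    have hcard : (T.preimage pos hpos.injOn).card ≤ T.card :=
      Finset.card_le_card_of_injOn pos (fun i hi => by simpa using hi) hpos.injOn
    obtain ⟨hrank, hnorm⟩ := hW (T.preimage pos hpos.injOn)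
    rw [← Finset.sum_preimage pos T hpos.injOn f (fun k _ hk => hfout k hk),
      ← Finset.sum_preimage pos T hpos.injOn (fun k => σ k ^ 2)
        (fun k _ hk => by rw [hσout k hk, zero_pow two_ne_zero])]
    simp only [hσpos, hfpos]
    rw [← hnorm, ← map_sum]
    exact hRIP _ (hrank.trans (hcard.trans hT))
  have hfsum : ∑ k ∈ Finset.range ((N + 2) * s), f k = 0 := by
    rw [← Finset.sum_preimage pos _ hpos.injOn f (fun k _ hk => hfout k hk), hpre]
    simp only [hfpos]
    rw [← map_sum, hWsum, hZ]
  have hsq := sum_sq_le_of_restricted_isometry hs hδ0 hδ1 hσanti hσ0 hf hfsum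
  have hbound := sum_rpow_le_of_sum_sq_le (n := (N + 2) * s)
    (C := ((1 + δ) / (1 - δ)) ^ ((1 : ℝ) / 2)) hs (by nlinarith) hq1 hq2 hC hσanti hσ0 (by
      rwa [mul_pow, ← Real.sqrt_eq_rpow, Real.sq_sqrt (by linarith)])
  have hone := hsumσ 1 one_ne_zero
  simp only [Real.rpow_one] at hone
  rw [hsumσ q hq0.ne', hone] at hbound
  simpa [schattenNorm] using hbound
end

section
/- Let 0 < p ≤ 1, let N, s be positive integers with s ≤ N, and let X, X* ∈ M_N satisfy ‖X*‖_{S_p} ≤ ‖X‖_{S_p}. Set Z = X − X*. Fix a singular value decomposition X = U diag(λ) Vᵀ with U, V orthogonal and λ the nonincreasing vector of singular values of X; write Uᵀ Z V in block form with blocks Z₁₁ (s×s), Z₁₂ (s×(N−s)), Z₂₁ ((N−s)×s), Z₂₂ ((N−s)×(N−s)), and define Z_{(s)} = U [Z₁₁, Z₁₂; Z₂₁, 0] Vᵀ and Z_{(s)}^c = U [0, 0; 0, Z₂₂] Vᵀ. Then ‖Z_{(s)}^c‖_{S_p}^p ≤ 2 ρ_s(X)_{S_p}^p + ‖Z_{(s)}‖_{S_p}^p.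 -/
open scoped Matrix

/-- Best rank-`s` approximation error in the Schatten `p`-quasi-norm. -/
noncomputable def rhoS {N : ℕ} (p : ℝ) (s : ℕ) (X : Matrix (Fin N) (Fin N) ℝ) : ℝ :=
  sInf ((fun Y => schattenNorm p (X - Y)) '' {Y | Y.rank ≤ s})

theorem OrthonormalBasis.transpose_mul_self_of_columns {n : Type*} [Fintype n] [DecidableEq n]
    (b : OrthonormalBasis n ℝ (EuclideanSpace ℝ n)) :
    (Matrix.of fun i j => b j i)ᵀ * (Matrix.of fun i j => b j i) = 1 := by
  ext i j
  have h := orthonormal_iff_ite.mp b.orthonormal i j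
  rw [PiLp.inner_apply] at h
  simpa [Matrix.mul_apply, Matrix.one_apply, mul_comm] using h

/-- Singular value decomposition of a square real matrix. -/
theorem Matrix.exists_svd {n : Type*} [Fintype n] [DecidableEq n] (A : Matrix n n ℝ) :
    ∃ U V : Matrix n n ℝ, U * Uᵀ = 1 ∧ V * Vᵀ = 1 ∧
      A = U * Matrix.diagonal (fun i =>
        Real.sqrt ((Matrix.isHermitian_conjTranspose_mul_self A).eigenvalues i)) * Vᵀ := by
  set hA := Matrix.isHermitian_conjTranspose_mul_self A
  set σ : n → ℝ := fun i => Real.sqrt (hA.eigenvalues i)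
  have hnn : ∀ i, 0 ≤ hA.eigenvalues i :=
    (Matrix.posSemidef_conjTranspose_mul_self A).eigenvalues_nonneg
  have hσsq : ∀ i, σ i * σ i = hA.eigenvalues i := fun i => Real.mul_self_sqrt (hnn i)
  obtain ⟨V, hV1, hspec⟩ : ∃ V : Matrix n n ℝ, Vᵀ * V = 1 ∧
      Aᵀ * A = V * Matrix.diagonal hA.eigenvalues * Vᵀ := by
    refine ⟨hA.eigenvectorUnitary.1, ?_, ?_⟩
    · have := Unitary.coe_star_mul_self hA.eigenvectorUnitary
      simpa [Matrix.star_eq_conjTranspose] using this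
    · have := hA.spectral_theorem
      simpa [Matrix.star_eq_conjTranspose, Unitary.conjStarAlgAut_apply,
        Function.comp_def] using this
  have hV2 : V * Vᵀ = 1 := mul_eq_one_comm.mp hV1
  have hAV : (A * V)ᵀ * (A * V) = Matrix.diagonal hA.eigenvalues := by
    calc (A * V)ᵀ * (A * V) = Vᵀ * (Aᵀ * A) * V := by
          simp [Matrix.transpose_mul, Matrix.mul_assoc]
      _ = (Vᵀ * V) * Matrix.diagonal hA.eigenvalues * (Vᵀ * V) := by
          rw [hspec]; simp only [Matrix.mul_assoc]
      _ = _ := by simp [hV1]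
  let w : n → EuclideanSpace ℝ n := fun i => WithLp.toLp 2 (fun k => (σ i)⁻¹ * (A * V) k i)
  have hentry : ∀ i j, ∑ k, (A * V) k i * (A * V) k j =
      if i = j then hA.eigenvalues i else 0 := by
    intro i j
    rw [← Matrix.diagonal_apply, ← hAV, Matrix.mul_apply]
    rfl
  have hw : Orthonormal ℝ ({i | σ i ≠ 0}.domRestrict w) := by
    rw [orthonormal_iff_ite]
    rintro ⟨i, hi⟩ ⟨j, hj⟩
    have hi' : σ i ≠ 0 := hi
    have : inner ℝ (w i) (w j) = (σ i)⁻¹ * (σ j)⁻¹ * ∑ k, (A * V) k i * (A * V) k j := by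
      rw [PiLp.inner_apply, Finset.mul_sum]
      refine Finset.sum_congr rfl fun k _ => ?_
      simp only [w, RCLike.inner_apply, conj_trivial]
      ring
    simp only [Set.domRestrict_apply, this, hentry, Subtype.mk.injEq]
    split_ifs with h
    · subst h
      rw [← hσsq]
      field_simp
    · simp
  obtain ⟨b, hb⟩ := hw.exists_orthonormalBasis_extension_of_card_eq (by simp)
  have hU := OrthonormalBasis.transpose_mul_self_of_columns b
  set U : Matrix n n ℝ := Matrix.of fun i j => b j i with hUdef
  refine ⟨U, V, mul_eq_one_comm.mp hU, hV2, ?_⟩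
  have key : A * V = U * Matrix.diagonal σ := by
    ext k i
    rw [Matrix.mul_diagonal]
    by_cases hi : σ i = 0
    · have h0 := hentry i i
      rw [if_pos rfl, ← hσsq, hi, mul_zero,
        Finset.sum_eq_zero_iff_of_nonneg (fun k _ => mul_self_nonneg _)] at h0
      rw [hi, mul_zero]
      exact mul_self_eq_zero.mp (h0 k (Finset.mem_univ k))
    · have : U k i = (σ i)⁻¹ * (A * V) k i := by
        simp only [hUdef, Matrix.of_apply, hb i hi, w]
      rw [this]
      field_simp
  rw [← key, Matrix.mul_assoc, hV2, Matrix.mul_one]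

/-- A matrix `B` is annihilated by an orthogonal projection of trace `n - rank B`. -/
theorem Matrix.exists_projection_mul_eq_zero {n : Type*} [Fintype n] [DecidableEq n]
    (B : Matrix n n ℝ) :
    ∃ P : Matrix n n ℝ, Pᵀ = P ∧ P * P = P ∧ B * P = 0 ∧
      P.trace + B.rank = Fintype.card n := by
  obtain ⟨U, V, hU, hV, hB⟩ := B.exists_svd
  set σ : n → ℝ := fun i =>
    Real.sqrt ((Matrix.isHermitian_conjTranspose_mul_self B).eigenvalues i)
  have hV' : Vᵀ * V = 1 := mul_eq_one_comm.mp hV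
  have hU' : Uᵀ * U = 1 := mul_eq_one_comm.mp hU
  set D : Matrix n n ℝ := Matrix.diagonal fun i => if σ i = 0 then 1 else 0 with hD
  refine ⟨V * D * Vᵀ, ?_, ?_, ?_, ?_⟩
  · simp [hD, Matrix.transpose_mul, Matrix.mul_assoc]
  · calc V * D * Vᵀ * (V * D * Vᵀ) = V * D * (Vᵀ * V) * D * Vᵀ := by
          simp only [Matrix.mul_assoc]
      _ = V * (D * D) * Vᵀ := by rw [hV', Matrix.mul_one]; simp only [Matrix.mul_assoc]
      _ = _ := by
          congr 2
          rw [hD, Matrix.diagonal_mul_diagonal]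
          congr 1
          ext i
          split_ifs <;> simp
  · calc B * (V * D * Vᵀ) = U * Matrix.diagonal σ * (Vᵀ * V) * D * Vᵀ := by
          nth_rewrite 1 [hB]; simp only [Matrix.mul_assoc]
      _ = U * (Matrix.diagonal σ * D) * Vᵀ := by
          rw [hV', Matrix.mul_one]; simp only [Matrix.mul_assoc]
      _ = 0 := by
          have h0 : (fun i => σ i * if σ i = 0 then 1 else 0) = 0 := by
            ext i
            by_cases h : σ i = 0 <;> simp [h]
          rw [hD, Matrix.diagonal_mul_diagonal, h0]
          simp
  · have hr : B.rank = Fintype.card {i // σ i ≠ 0} := by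
      rw [← Matrix.rank_diagonal, hB, Matrix.rank_mul_eq_left_of_isUnit_det,
        Matrix.rank_mul_eq_right_of_isUnit_det]
      · exact Matrix.isUnit_det_of_left_inverse hU'
      · exact Matrix.isUnit_det_of_left_inverse hV
    rw [Matrix.trace_mul_cycle, hV', Matrix.one_mul, hD, Matrix.trace_diagonal, hr,
      Fintype.card_subtype, Finset.sum_boole]
    exact_mod_cast Finset.card_filter_add_card_filter_not (fun i => σ i = 0)

theorem Matrix.apply_self_mem_Icc_of_projection {n : Type*} [Fintype n]
    {Q : Matrix n n ℝ} (hQ : Qᵀ = Q) (hQQ : Q * Q = Q) (i : n) : Q i i ∈ Set.Icc (0 : ℝ) 1 := by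
  have h : Q i i = ∑ k, Q i k ^ 2 := by
    conv_lhs => rw [← hQQ, Matrix.mul_apply]
    refine Finset.sum_congr rfl fun k _ => ?_
    rw [sq, ← Matrix.transpose_apply Q k i, hQ]
  have h2 : Q i i ^ 2 ≤ Q i i := by
    conv_rhs => rw [h]
    exact Finset.single_le_sum (f := fun k => Q i k ^ 2) (fun k _ => sq_nonneg _)
      (Finset.mem_univ i)
  constructor <;> nlinarith [sq_nonneg (Q i i - 1)]

theorem Matrix.trace_svd_mul_projection_le {n : Type*} [Fintype n] [DecidableEq n]
    {G H P : Matrix n n ℝ} (hG : G * Gᵀ = 1) (hH : H * Hᵀ = 1) (hP : Pᵀ = P) (hPP : P * P = P)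
    {d : n → ℝ} (hd : ∀ i, 0 ≤ d i) :
    (G * Matrix.diagonal d * Hᵀ * P).trace ≤ ∑ i, d i := by
  have hproj : ∀ K : Matrix n n ℝ, K * Kᵀ = 1 → ∀ i, ∑ k, (P * K) k i ^ 2 ≤ 1 := by
    intro K hK i
    have h := (Matrix.apply_self_mem_Icc_of_projection (Q := Kᵀ * P * K)
      (by simp [Matrix.transpose_mul, hP, Matrix.mul_assoc])
      (calc Kᵀ * P * K * (Kᵀ * P * K) = Kᵀ * P * (K * Kᵀ) * P * K := by
              simp only [Matrix.mul_assoc]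
        _ = Kᵀ * (P * P) * K := by rw [hK, Matrix.mul_one]; simp only [Matrix.mul_assoc]
        _ = _ := by rw [hPP]) i).2
    have h' : Kᵀ * P * K = (P * K)ᵀ * (P * K) := by
      rw [Matrix.transpose_mul, hP, ← Matrix.mul_assoc, Matrix.mul_assoc Kᵀ P P, hPP]
    rw [h', Matrix.mul_apply] at h
    simpa [sq] using h
  have h1 : (G * Matrix.diagonal d * Hᵀ * P).trace =
      ((P * H)ᵀ * (P * G) * Matrix.diagonal d).trace := by
    rw [Matrix.transpose_mul, hP, ← Matrix.mul_assoc, Matrix.mul_assoc Hᵀ P P, hPP,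
      Matrix.mul_assoc, Matrix.mul_assoc, Matrix.trace_mul_comm, Matrix.mul_assoc,
      Matrix.trace_mul_comm]
  rw [h1, Matrix.trace]
  refine Finset.sum_le_sum fun i _ => ?_
  rw [Matrix.diag_apply, Matrix.mul_diagonal]
  refine mul_le_of_le_one_left (hd i) ?_
  rw [Matrix.mul_apply]
  have h2 : ∑ k, (P * H)ᵀ i k * (P * G) k i ≤
      ∑ k, ((P * H) k i ^ 2 + (P * G) k i ^ 2) / 2 := by
    refine Finset.sum_le_sum fun k _ => ?_
    rw [Matrix.transpose_apply]
    nlinarith [sq_nonneg ((P * H) k i - (P * G) k i)]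
  rw [← Finset.sum_div, Finset.sum_add_distrib] at h2
  linarith [hproj H hH i, hproj G hG i]

theorem Matrix.rank_add_le_rank_add_rank {n : Type*} [Fintype n] (A B : Matrix n n ℝ) :
    (A + B).rank ≤ A.rank + B.rank := by
  have h : LinearMap.range (A + B).mulVecLin ≤
      LinearMap.range A.mulVecLin ⊔ LinearMap.range B.mulVecLin := by
    rw [Matrix.mulVecLin_add]
    rintro _ ⟨x, rfl⟩
    exact Submodule.add_mem_sup ⟨x, rfl⟩ ⟨x, rfl⟩
  exact (Submodule.finrank_mono h).trans
    (Submodule.finrank_add_le_finrank_add_finrank _ _)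

theorem Matrix.exists_svd_split {n : Type*} [Fintype n] [DecidableEq n]
    {A U V : Matrix n n ℝ} {a : n → ℝ} (ha : ∀ i, 0 ≤ a i)
    (hA : A = U * Matrix.diagonal a * Vᵀ) {c : ℝ} (hc : 0 ≤ c) :
    ∃ (d : n → ℝ) (R : Matrix n n ℝ), (∀ i, 0 ≤ d i) ∧ A = U * Matrix.diagonal d * Vᵀ + R ∧
      ∑ i, d i + c * R.rank ≤ ∑ i, min (a i) c := by
  refine ⟨fun i => if c < a i then 0 else a i,
    U * Matrix.diagonal (fun i => if c < a i then a i else 0) * Vᵀ, fun i => ?_, ?_, ?_⟩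
  · dsimp only
    split_ifs
    exacts [le_rfl, ha i]
  · rw [hA, ← Matrix.add_mul, ← Matrix.mul_add, Matrix.diagonal_add]
    congr 3
    ext i
    split_ifs <;> simp
  · have hr : (U * Matrix.diagonal (fun i => if c < a i then a i else 0) * Vᵀ).rank ≤
        (Finset.univ.filter fun i => c < a i).card := by
      refine ((Matrix.rank_mul_le_left _ _).trans (Matrix.rank_mul_le_right _ _)).trans ?_
      rw [Matrix.rank_diagonal, Fintype.card_subtype]
      refine Finset.card_le_card fun i => ?_
      simp only [Finset.mem_filter, Finset.mem_univ, true_and]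
      intro h
      by_contra hc
      simp [hc] at h
    have hr' : c * ((U * Matrix.diagonal (fun i => if c < a i then a i else 0) * Vᵀ).rank : ℝ) ≤
        ∑ i, if c < a i then c else 0 := by
      rw [← Finset.sum_filter, Finset.sum_const, nsmul_eq_mul, mul_comm]
      gcongr
    refine (add_le_add_right hr' _).trans ?_
    rw [← Finset.sum_add_distrib]
    refine Finset.sum_le_sum fun i _ => ?_
    split_ifs with h
    · simp [h.le]
    · simp [not_lt.mp h]

/-- If `A + B + Y = U diag(l) Vᵀ` with `Y` of rank at most `#T`, where `T` indexes the largest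
entries of `l`, the truncated sum of the remaining entries is at most the sum of the truncated
singular values of `A` and of `B`. -/
theorem sum_compl_min_le_of_svd {n : Type*} [Fintype n] [DecidableEq n]
    {A B Y U V U₁ V₁ U₂ V₂ : Matrix n n ℝ} {l a b : n → ℝ} {T : Finset n} {μ c : ℝ}
    (hU : U * Uᵀ = 1) (hV : V * Vᵀ = 1) (hU₁ : U₁ * U₁ᵀ = 1) (hV₁ : V₁ * V₁ᵀ = 1)
    (hU₂ : U₂ * U₂ᵀ = 1) (hV₂ : V₂ * V₂ᵀ = 1)
    (ha : ∀ i, 0 ≤ a i) (hb : ∀ i, 0 ≤ b i)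
    (hA : A = U₁ * Matrix.diagonal a * V₁ᵀ) (hB : B = U₂ * Matrix.diagonal b * V₂ᵀ)
    (hl : A + B + Y = U * Matrix.diagonal l * Vᵀ) (hY : Y.rank ≤ T.card)
    (hμ : 0 ≤ μ) (hc : 0 ≤ c) (hT : ∀ i ∈ T, μ ≤ l i) (hT' : ∀ i ∉ T, l i ≤ μ) :
    ∑ i ∈ Tᶜ, min (l i) c ≤ ∑ i, min (a i) c + ∑ i, min (b i) c := by
  obtain ⟨d, R, hd, hAR, hdR⟩ := Matrix.exists_svd_split ha hA hc
  obtain ⟨e, S, he, hBS, heS⟩ := Matrix.exists_svd_split hb hB hc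
  have hU' : Uᵀ * U = 1 := mul_eq_one_comm.mp hU
  have hV' : Vᵀ * V = 1 := mul_eq_one_comm.mp hV
  obtain ⟨P, hP, hPP, hKP, htr⟩ := Matrix.exists_projection_mul_eq_zero (Uᵀ * (R + S + Y) * V)
  have hrank : ((Uᵀ * (R + S + Y) * V).rank : ℝ) ≤ R.rank + S.rank + T.card := by
    have h1 := (Matrix.rank_mul_le_left (Uᵀ * (R + S + Y)) V).trans
      (Matrix.rank_mul_le_right Uᵀ (R + S + Y))
    have h2 := Matrix.rank_add_le_rank_add_rank (R + S) Y
    have h3 := Matrix.rank_add_le_rank_add_rank R S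
    exact_mod_cast (by omega :
      (Uᵀ * (R + S + Y) * V).rank ≤ R.rank + S.rank + T.card)
  have hdiag : Matrix.diagonal l * P =
      (Uᵀ * U₁) * Matrix.diagonal d * (Vᵀ * V₁)ᵀ * P +
        (Uᵀ * U₂) * Matrix.diagonal e * (Vᵀ * V₂)ᵀ * P := by
    have h1 : Matrix.diagonal l = Uᵀ * (A + B + Y) * V := by
      calc Matrix.diagonal l = (Uᵀ * U) * Matrix.diagonal l * (Vᵀ * V) := by
            rw [hU', hV', Matrix.one_mul, Matrix.mul_one]
        _ = _ := by rw [hl]; simp only [Matrix.mul_assoc]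
    have h2 : A + B + Y =
        U₁ * Matrix.diagonal d * V₁ᵀ + U₂ * Matrix.diagonal e * V₂ᵀ + (R + S + Y) := by
      rw [hAR, hBS]
      abel
    rw [h1, h2, Matrix.mul_add, Matrix.add_mul, Matrix.add_mul, hKP, add_zero]
    simp only [Matrix.mul_add, Matrix.add_mul, Matrix.transpose_mul, Matrix.transpose_transpose,
      Matrix.mul_assoc]
  have horth : ∀ K L : Matrix n n ℝ, K * Kᵀ = 1 → Lᵀ * L = 1 → (Lᵀ * K) * (Lᵀ * K)ᵀ = 1 := by
    intro K L hK hL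
    rw [Matrix.transpose_mul, Matrix.transpose_transpose, ← Matrix.mul_assoc,
      Matrix.mul_assoc Lᵀ, hK, Matrix.mul_one, hL]
  have h1 := Matrix.trace_svd_mul_projection_le (horth _ _ hU₁ hU') (horth _ _ hV₁ hV') hP hPP hd
  have h2 := Matrix.trace_svd_mul_projection_le (horth _ _ hU₂ hU') (horth _ _ hV₂ hV') hP hPP he
  have htrace : ∑ i, l i * P i i ≤ ∑ i, d i + ∑ i, e i := by
    have h3 := congrArg Matrix.trace hdiag
    rw [Matrix.trace_add, Matrix.trace] at h3
    simp only [Matrix.diag_apply, Matrix.diagonal_mul] at h3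
    linarith
  have hPi := Matrix.apply_self_mem_Icc_of_projection hP hPP
  set ν := min μ c
  have hν0 : 0 ≤ ν := le_min hμ hc
  -- Compare termwise, using the threshold `ν` to trade the trace of `1 - P` against `#T`.
  have hterm : ∀ i, (if i ∈ T then 0 else min (l i) c) ≤
      l i * P i i + ν * (1 - P i i) - (if i ∈ T then ν else 0) := by
    intro i
    obtain ⟨hi0, hi1⟩ := hPi i
    split_ifs with hi
    · have : ν ≤ l i := (min_le_left _ _).trans (hT i hi)
      nlinarith
    · have h4 : min (l i) c ≤ ν := le_min ((min_le_left _ _).trans (hT' i hi)) (min_le_right _ _)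
      have h5 : min (l i) c ≤ l i := min_le_left _ _
      nlinarith
  have hsum := Finset.sum_le_sum fun i (_ : i ∈ Finset.univ) => hterm i
  rw [Finset.sum_sub_distrib, Finset.sum_add_distrib, ← Finset.mul_sum, Finset.sum_sub_distrib,
    Finset.sum_const, Finset.card_univ, nsmul_eq_mul, mul_one, Finset.sum_ite_mem,
    Finset.univ_inter, Finset.sum_const, nsmul_eq_mul] at hsum
  have hlhs : ∑ i ∈ Tᶜ, min (l i) c = ∑ i, if i ∈ T then 0 else min (l i) c := by
    rw [← Finset.sum_filter_add_sum_filter_not Finset.univ (· ∈ T)]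
    simp [Finset.sum_ite, Finset.compl_eq_univ_sdiff, Finset.filter_notMem_eq_sdiff]
  have htr' : (Fintype.card n : ℝ) - ∑ i, P i i ≤ R.rank + S.rank + T.card := by
    have : P.trace = ∑ i, P i i := rfl
    linarith
  have h6 := mul_le_mul_of_nonneg_left htr' hν0
  have h7 : ν * ((R.rank : ℝ) + S.rank) ≤ c * (R.rank + S.rank) :=
    mul_le_mul_of_nonneg_right (min_le_right _ _) (by positivity)
  rw [hlhs]
  nlinarith

open MeasureTheory Set in
theorem integrableOn_min_mul_rpow_and_integral {p : ℝ} (hp0 : 0 < p) (hp1 : p < 1) {t : ℝ}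
    (ht : 0 ≤ t) :
    IntegrableOn (fun c : ℝ => min t c * c ^ (p - 2)) (Ioi 0) ∧
      ∫ c in Ioi (0 : ℝ), min t c * c ^ (p - 2) = t ^ p * (1 / p + 1 / (1 - p)) := by
  rcases ht.eq_or_lt with rfl | ht
  · have h0 : EqOn (fun c : ℝ => min 0 c * c ^ (p - 2)) (fun _ => 0) (Ioi 0) := by
      intro c hc
      simp [(mem_Ioi.mp hc).le]
    refine ⟨integrableOn_zero.congr_fun h0.symm measurableSet_Ioi, ?_⟩
    rw [setIntegral_congr_fun measurableSet_Ioi h0]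
    simp [Real.zero_rpow hp0.ne']
  have hsmall : EqOn (fun c : ℝ => c ^ (p - 1)) (fun c : ℝ => min t c * c ^ (p - 2))
      (Ioc 0 t) := by
    intro c hc
    dsimp only
    rw [min_eq_right hc.2, ← Real.rpow_one_add' hc.1.le (by linarith)]
    ring_nf
  have hlarge : EqOn (fun c : ℝ => t * c ^ (p - 2)) (fun c : ℝ => min t c * c ^ (p - 2))
      (Ioi t) := by
    intro c hc
    dsimp only
    rw [min_eq_left (mem_Ioi.mp hc).le]
  have hi1 : IntegrableOn (fun c : ℝ => min t c * c ^ (p - 2)) (Ioc 0 t) := by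
    refine IntegrableOn.congr_fun ?_ hsmall measurableSet_Ioc
    rw [← intervalIntegrable_iff_integrableOn_Ioc_of_le ht.le]
    exact intervalIntegral.intervalIntegrable_rpow' (by linarith)
  have hi2 : IntegrableOn (fun c : ℝ => min t c * c ^ (p - 2)) (Ioi t) :=
    IntegrableOn.congr_fun ((integrableOn_Ioi_rpow_of_lt (by linarith) ht).const_mul t) hlarge
      measurableSet_Ioi
  rw [← Ioc_union_Ioi_eq_Ioi ht.le]
  refine ⟨hi1.union hi2, ?_⟩
  rw [setIntegral_union (Ioc_disjoint_Ioi le_rfl) measurableSet_Ioi hi1 hi2,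
    ← setIntegral_congr_fun measurableSet_Ioc hsmall,
    ← setIntegral_congr_fun measurableSet_Ioi hlarge, integral_const_mul,
    integral_Ioi_rpow_of_lt (by linarith) ht, ← intervalIntegral.integral_of_le ht.le,
    integral_rpow (Or.inl (by linarith))]
  have h1 : p - 1 + 1 = p := by ring
  have h2 : p - 2 + 1 = p - 1 := by ring
  have h3 : t * t ^ (p - 1) = t ^ p := by
    rw [← Real.rpow_one_add' ht.le (by linarith)]
    ring_nf
  rw [h1, h2, Real.zero_rpow hp0.ne', ← h3]
  have h4 : p - 1 ≠ 0 := by linarith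
  have h5 : 1 - p ≠ 0 := by linarith
  field_simp
  ring

open MeasureTheory Set in
theorem integrableOn_sum_min_mul_rpow_and_integral {ι : Type*} (r : Finset ι) {z : ι → ℝ}
    (hz : ∀ i, 0 ≤ z i) {p : ℝ} (hp0 : 0 < p) (hp1 : p < 1) :
    IntegrableOn (fun c : ℝ => (∑ i ∈ r, min (z i) c) * c ^ (p - 2)) (Ioi 0) ∧
      ∫ c in Ioi (0 : ℝ), (∑ i ∈ r, min (z i) c) * c ^ (p - 2) =
        (∑ i ∈ r, z i ^ p) * (1 / p + 1 / (1 - p)) := by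
  have h := fun i => integrableOn_min_mul_rpow_and_integral hp0 hp1 (hz i)
  simp only [Finset.sum_mul]
  refine ⟨integrable_finsetSum r fun i _ => (h i).1, ?_⟩
  rw [integral_finsetSum r fun i _ => (h i).1]
  exact Finset.sum_congr rfl fun i _ => (h i).2

open MeasureTheory Set in
/-- Domination of all truncated sums implies domination of the sums of `p`-th powers. -/
theorem sum_rpow_le_sum_rpow_of_sum_min_le {ι κ : Type*} (s : Finset ι) (t : Finset κ)
    {x : ι → ℝ} {y : κ → ℝ} (hx : ∀ i, 0 ≤ x i) (hy : ∀ k, 0 ≤ y k) {p : ℝ} (hp0 : 0 < p)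
    (hp1 : p ≤ 1) (h : ∀ c, 0 ≤ c → ∑ i ∈ s, min (x i) c ≤ ∑ k ∈ t, min (y k) c) :
    ∑ i ∈ s, x i ^ p ≤ ∑ k ∈ t, y k ^ p := by
  rcases hp1.eq_or_lt with rfl | hp1
  · simp only [Real.rpow_one]
    have hle : ∀ i ∈ s, x i ≤ ∑ j ∈ s, x j := fun i hi =>
      Finset.single_le_sum (f := x) (fun j _ => hx j) hi
    calc ∑ i ∈ s, x i = ∑ i ∈ s, min (x i) (∑ j ∈ s, x j) :=
          Finset.sum_congr rfl fun i hi => (min_eq_left (hle i hi)).symm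
      _ ≤ _ := h _ (Finset.sum_nonneg fun j _ => hx j)
      _ ≤ _ := Finset.sum_le_sum fun k _ => min_le_left _ _
  obtain ⟨hxi, hxv⟩ := integrableOn_sum_min_mul_rpow_and_integral s hx hp0 hp1
  obtain ⟨hyi, hyv⟩ := integrableOn_sum_min_mul_rpow_and_integral t hy hp0 hp1
  have hmono := setIntegral_mono_on hxi hyi measurableSet_Ioi fun c hc =>
    mul_le_mul_of_nonneg_right (h c (mem_Ioi.mp hc).le)
      (Real.rpow_nonneg (mem_Ioi.mp hc).le (p - 2))
  rw [hxv, hyv] at hmono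
  have hpos : 0 < 1 / p + 1 / (1 - p) := by
    have : 0 < 1 - p := by linarith
    positivity
  exact le_of_mul_le_mul_right hmono hpos

theorem sum_compl_rpow_le_of_svd {n : Type*} [Fintype n] [DecidableEq n]
    {A B Y U V U₁ V₁ U₂ V₂ : Matrix n n ℝ} {l a b : n → ℝ} {T : Finset n} {μ p : ℝ}
    (hp0 : 0 < p) (hp1 : p ≤ 1)
    (hU : U * Uᵀ = 1) (hV : V * Vᵀ = 1) (hU₁ : U₁ * U₁ᵀ = 1) (hV₁ : V₁ * V₁ᵀ = 1)
    (hU₂ : U₂ * U₂ᵀ = 1) (hV₂ : V₂ * V₂ᵀ = 1)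
    (hl0 : ∀ i, 0 ≤ l i) (ha : ∀ i, 0 ≤ a i) (hb : ∀ i, 0 ≤ b i)
    (hA : A = U₁ * Matrix.diagonal a * V₁ᵀ) (hB : B = U₂ * Matrix.diagonal b * V₂ᵀ)
    (hl : A + B + Y = U * Matrix.diagonal l * Vᵀ) (hY : Y.rank ≤ T.card)
    (hμ : 0 ≤ μ) (hT : ∀ i ∈ T, μ ≤ l i) (hT' : ∀ i ∉ T, l i ≤ μ) :
    ∑ i ∈ Tᶜ, l i ^ p ≤ ∑ i, a i ^ p + ∑ i, b i ^ p := by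
  have h := sum_rpow_le_sum_rpow_of_sum_min_le Tᶜ (Finset.univ : Finset (n ⊕ n)) (x := l)
    (y := Sum.elim a b) hl0 (by rintro (i | i) <;> simp [ha, hb]) hp0 hp1 fun c hc => by
      simpa using sum_compl_min_le_of_svd hU hV hU₁ hV₁ hU₂ hV₂ ha hb hA hB hl hY hμ hc hT hT'
  simpa using h

theorem singVals_nonneg {N : ℕ} (X : Matrix (Fin N) (Fin N) ℝ) (i : Fin N) : 0 ≤ singVals X i :=
  Real.sqrt_nonneg _

theorem sum_singVals_rpow_nonneg {N : ℕ} (p : ℝ) (X : Matrix (Fin N) (Fin N) ℝ) :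
    0 ≤ ∑ i, singVals X i ^ p :=
  Finset.sum_nonneg fun i _ => Real.rpow_nonneg (singVals_nonneg X i) p

theorem schattenNorm_nonneg {N : ℕ} (p : ℝ) (X : Matrix (Fin N) (Fin N) ℝ) :
    0 ≤ schattenNorm p X :=
  Real.rpow_nonneg (sum_singVals_rpow_nonneg p X) _

theorem schattenNorm_rpow {N : ℕ} {p : ℝ} (hp0 : 0 < p) (X : Matrix (Fin N) (Fin N) ℝ) :
    schattenNorm p X ^ p = ∑ i, singVals X i ^ p := by
  rw [schattenNorm, ← Real.rpow_mul (sum_singVals_rpow_nonneg p X), one_div_mul_cancel hp0.ne',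
    Real.rpow_one]

theorem schattenNorm_rpow_add_le {N : ℕ} {p : ℝ} (hp0 : 0 < p) (hp1 : p ≤ 1)
    (A B : Matrix (Fin N) (Fin N) ℝ) :
    schattenNorm p (A + B) ^ p ≤ schattenNorm p A ^ p + schattenNorm p B ^ p := by
  obtain ⟨U, V, hU, hV, h⟩ := (A + B).exists_svd
  obtain ⟨U₁, V₁, hU₁, hV₁, hA⟩ := A.exists_svd
  obtain ⟨U₂, V₂, hU₂, hV₂, hB⟩ := B.exists_svd
  simp only [schattenNorm_rpow hp0]
  have key := sum_compl_rpow_le_of_svd (Y := 0) (T := ∅) (μ := ∑ i, singVals (A + B) i) hp0 hp1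
    hU hV hU₁ hV₁ hU₂ hV₂ (singVals_nonneg (A + B)) (singVals_nonneg A) (singVals_nonneg B)
    hA hB (by rw [add_zero]; exact h) (by simp)
    (Finset.sum_nonneg fun i _ => singVals_nonneg (A + B) i) (by simp)
    (fun i _ => Finset.single_le_sum (fun j _ => singVals_nonneg (A + B) j) (Finset.mem_univ i))
  simpa using key

/-- Mirsky's lower bound, with `T` indexing the largest singular values. -/
theorem sum_compl_rpow_le_schattenNorm_sub {N : ℕ} {p : ℝ} (hp0 : 0 < p) (hp1 : p ≤ 1)
    {X Y U V : Matrix (Fin N) (Fin N) ℝ} {l : Fin N → ℝ} {T : Finset (Fin N)} {μ : ℝ}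
    (hU : U * Uᵀ = 1) (hV : V * Vᵀ = 1) (hl0 : ∀ i, 0 ≤ l i)
    (hX : X = U * Matrix.diagonal l * Vᵀ) (hY : Y.rank ≤ T.card)
    (hμ : 0 ≤ μ) (hT : ∀ i ∈ T, μ ≤ l i) (hT' : ∀ i ∉ T, l i ≤ μ) :
    ∑ i ∈ Tᶜ, l i ^ p ≤ schattenNorm p (X - Y) ^ p := by
  obtain ⟨U₁, V₁, hU₁, hV₁, hA⟩ := (X - Y).exists_svd
  have key := sum_compl_rpow_le_of_svd (B := 0) (b := fun _ => 0) (U₂ := 1) (V₂ := 1) hp0 hp1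
    hU hV hU₁ hV₁ (by simp) (by simp) hl0 (singVals_nonneg (X - Y)) (by simp) hA (by simp)
    (by rw [add_zero, sub_add_cancel]; exact hX) hY hμ hT hT'
  rw [schattenNorm_rpow hp0]
  simpa [Real.zero_rpow hp0.ne'] using key

theorem schattenNorm_rpow_of_svd {N : ℕ} {p : ℝ} (hp0 : 0 < p) (hp1 : p ≤ 1)
    {X U V : Matrix (Fin N) (Fin N) ℝ} {l : Fin N → ℝ}
    (hU : U * Uᵀ = 1) (hV : V * Vᵀ = 1) (hl0 : ∀ i, 0 ≤ l i)
    (hX : X = U * Matrix.diagonal l * Vᵀ) :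
    schattenNorm p X ^ p = ∑ i, l i ^ p := by
  apply le_antisymm
  · obtain ⟨U₁, V₁, hU₁, hV₁, hA⟩ := X.exists_svd
    have key := sum_compl_rpow_le_of_svd (B := 0) (Y := 0) (b := fun _ => 0) (U₂ := 1) (V₂ := 1)
      (T := ∅) (μ := ∑ i, singVals X i) hp0 hp1
      hU₁ hV₁ hU hV (by simp) (by simp) (singVals_nonneg X) hl0 (by simp) hX (by simp)
      (by rw [add_zero, add_zero]; exact hA) (by simp)
      (Finset.sum_nonneg fun i _ => singVals_nonneg X i) (by simp)
      (fun i _ => Finset.single_le_sum (fun j _ => singVals_nonneg X j) (Finset.mem_univ i))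
    rw [schattenNorm_rpow hp0]
    simpa [Real.zero_rpow hp0.ne'] using key
  · have key := sum_compl_rpow_le_schattenNorm_sub (Y := 0) (T := ∅) (μ := ∑ i, l i) hp0 hp1
      hU hV hl0 hX (by simp) (Finset.sum_nonneg fun i _ => hl0 i) (by simp)
      (fun i _ => Finset.single_le_sum (fun j _ => hl0 j) (Finset.mem_univ i))
    simpa using key

/-- A matrix supported on the block `¬ q` has a singular value decomposition whose orthogonal
factors act trivially on the block `q`. -/
theorem Matrix.exists_svd_of_block {n : Type*} [Fintype n] [DecidableEq n] (q : n → Prop)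
    [DecidablePred q] (K : Matrix n n ℝ) (hK : ∀ i j, q i ∨ q j → K i j = 0) :
    ∃ (G H : Matrix n n ℝ) (σ : n → ℝ), G * Gᵀ = 1 ∧ H * Hᵀ = 1 ∧ (∀ i, 0 ≤ σ i) ∧
      (∀ i, q i → σ i = 0) ∧ K = G * Matrix.diagonal σ * Hᵀ ∧
      ∀ w : n → ℝ, (∀ i, ¬ q i → w i = 0) → G * Matrix.diagonal w * Hᵀ = Matrix.diagonal w := by
  obtain ⟨U, V, hU, hV, hL⟩ :=
    (K.submatrix (Subtype.val : {i // ¬ q i} → n) Subtype.val).exists_svd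
  set τ : {i // ¬ q i} → ℝ := fun i => Real.sqrt ((Matrix.isHermitian_conjTranspose_mul_self
    (K.submatrix (Subtype.val : {i // ¬ q i} → n) Subtype.val)).eigenvalues i)
  let e : {i // q i} ⊕ {i // ¬ q i} ≃ n := Equiv.sumCompl q
  have hmul : ∀ L : Matrix {i // ¬ q i} {i // ¬ q i} ℝ, L * Lᵀ = 1 →
      (Matrix.fromBlocks (1 : Matrix {i // q i} {i // q i} ℝ) 0 0 L).submatrix e.symm e.symm *
        ((Matrix.fromBlocks (1 : Matrix {i // q i} {i // q i} ℝ) 0 0 L).submatrix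
          e.symm e.symm)ᵀ = 1 := by
    intro L hLL
    rw [Matrix.transpose_submatrix, Matrix.submatrix_mul_equiv, Matrix.fromBlocks_transpose,
      Matrix.fromBlocks_multiply]
    simp [hLL]
  have hsvd : ∀ (x : {i // q i} → ℝ) (y : {i // ¬ q i} → ℝ),
      (Matrix.fromBlocks (1 : Matrix {i // q i} {i // q i} ℝ) 0 0 U).submatrix e.symm e.symm *
        Matrix.diagonal (Sum.elim x y ∘ e.symm) *
        ((Matrix.fromBlocks (1 : Matrix {i // q i} {i // q i} ℝ) 0 0 V).submatrix
          e.symm e.symm)ᵀ =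
      (Matrix.fromBlocks (Matrix.diagonal x) 0 0 (U * Matrix.diagonal y * Vᵀ)).submatrix
        e.symm e.symm := by
    intro x y
    rw [← Matrix.submatrix_diagonal_equiv, ← Matrix.fromBlocks_diagonal,
      Matrix.transpose_submatrix, Matrix.submatrix_mul_equiv, Matrix.submatrix_mul_equiv,
      Matrix.fromBlocks_transpose, Matrix.fromBlocks_multiply, Matrix.fromBlocks_multiply]
    simp
  refine ⟨_, _, Sum.elim (fun _ => 0) τ ∘ e.symm, hmul U hU, hmul V hV, fun i => ?_,
    fun i hi => ?_, ?_, fun w hw => ?_⟩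
  · obtain ⟨k, rfl⟩ := e.surjective i
    rcases k with k | k
    · simp
    · simp only [Function.comp_apply, Equiv.symm_apply_apply, Sum.elim_inr]
      exact Real.sqrt_nonneg _
  · simp [e, Equiv.sumCompl_symm_apply_of_pos hi]
  · rw [hsvd, ← hL]
    ext i j
    obtain ⟨k, rfl⟩ := e.surjective i
    obtain ⟨m, rfl⟩ := e.surjective j
    rcases k with k | k <;> rcases m with m | m
    · simpa [e] using hK _ _ (Or.inl k.2)
    · simpa [e] using hK _ _ (Or.inl k.2)
    · simpa [e] using hK _ _ (Or.inr m.2)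
    · simp [e]
  · have hwe : w = Sum.elim (fun i => w i.1) (fun _ => 0) ∘ e.symm := by
      ext i
      obtain ⟨k, rfl⟩ := e.surjective i
      rcases k with k | k
      · simp [e]
      · simpa [e] using hw _ k.2
    rw [hwe, hsvd, ← Matrix.submatrix_diagonal_equiv, ← Matrix.fromBlocks_diagonal]
    simp

/-- Cone-type constraint from minimality: with `Z = X - X*` and the block decomposition of
`Z` relative to a singular value decomposition `X = U diag(λ) Vᵀ` (blocks of sizes `s` and
`N - s`), where `Z_{(s)}^c` keeps only the lower-right `(N-s) × (N-s)` block of `Uᵀ Z V`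
and `Z_{(s)} = Z - Z_{(s)}^c`, one has
`‖Z_{(s)}^c‖_{S_p}^p ≤ 2 ρ_s(X)_{S_p}^p + ‖Z_{(s)}‖_{S_p}^p`. -/
theorem cone_constraint_block_decomposition
    (p : ℝ) (hp0 : 0 < p) (hp1 : p ≤ 1)
    (N s : ℕ) (hN : 0 < N) (hs : 0 < s) (hsN : s ≤ N)
    (X Xstar : Matrix (Fin N) (Fin N) ℝ)
    (hmin : schattenNorm p Xstar ≤ schattenNorm p X)
    (U V : Matrix (Fin N) (Fin N) ℝ) (lam : Fin N → ℝ)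
    (hU : U * Uᵀ = 1) (hV : V * Vᵀ = 1)
    (hlam0 : ∀ i, 0 ≤ lam i) (hlammono : Antitone lam)
    (hSVD : X = U * Matrix.diagonal lam * Vᵀ) :
    schattenNorm p
        (U * (Matrix.of fun i j : Fin N =>
          if s ≤ (i : ℕ) ∧ s ≤ (j : ℕ) then (Uᵀ * (X - Xstar) * V) i j else 0) * Vᵀ) ^ p ≤
      2 * rhoS p s X ^ p +
        schattenNorm p ((X - Xstar) -
          U * (Matrix.of fun i j : Fin N =>
            if s ≤ (i : ℕ) ∧ s ≤ (j : ℕ) then (Uᵀ * (X - Xstar) * V) i j else 0) * Vᵀ) ^ p := by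
  set Z := X - Xstar with hZ
  set M : Matrix (Fin N) (Fin N) ℝ := Matrix.of fun i j : Fin N =>
    if s ≤ (i : ℕ) ∧ s ≤ (j : ℕ) then (Uᵀ * Z * V) i j else 0 with hM
  let T : Finset (Fin N) := Finset.univ.filter fun i => (i : ℕ) < s
  have hTcard : T.card = s := by
    rw [Fin.card_filter_val_lt, min_eq_right hsN]
  have hmemT : ∀ i, i ∈ T ↔ (i : ℕ) < s := fun i => by simp [T]
  set head : Fin N → ℝ := fun i => if (i : ℕ) < s then lam i else 0
  set tail : Fin N → ℝ := fun i => if (i : ℕ) < s then 0 else lam i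
  have hhead0 : ∀ i, 0 ≤ head i := fun i => by
    dsimp only [head]
    split_ifs
    exacts [hlam0 i, le_rfl]
  have htail0 : ∀ i, 0 ≤ tail i := fun i => by
    dsimp only [tail]
    split_ifs
    exacts [le_rfl, hlam0 i]
  have hsplit : Matrix.diagonal lam = Matrix.diagonal head + Matrix.diagonal tail := by
    rw [Matrix.diagonal_add]
    congr 1
    ext i
    by_cases h : (i : ℕ) < s <;> simp [head, tail, h]
  obtain ⟨G, H, σ, hG, hH, hσ0, hσq, hK, hfix⟩ :=
    Matrix.exists_svd_of_block (fun i : Fin N => (i : ℕ) < s) (Matrix.diagonal tail - M) (by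
      intro i j hij
      have hMij : M i j = 0 := by
        simp only [hM, Matrix.of_apply]
        exact if_neg (by omega)
      rw [Matrix.sub_apply, hMij, sub_zero, Matrix.diagonal_apply]
      split_ifs with h
      · subst h
        exact if_pos (by simpa using hij)
      · rfl)
  have horth : ∀ K L : Matrix (Fin N) (Fin N) ℝ, K * Kᵀ = 1 → L * Lᵀ = 1 →
      (K * L) * (K * L)ᵀ = 1 := by
    intro K L hKK hLL
    rw [Matrix.transpose_mul, ← Matrix.mul_assoc, Matrix.mul_assoc K, hLL, Matrix.mul_one, hKK]
  have hUG := horth U G hU hG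
  have hVH := horth V H hV hH
  have hXnorm := schattenNorm_rpow_of_svd hp0 hp1 hU hV hlam0 hSVD
  have hlamsum : ∑ i, lam i ^ p = ∑ i, head i ^ p + ∑ i, tail i ^ p := by
    rw [← Finset.sum_add_distrib]
    refine Finset.sum_congr rfl fun i _ => ?_
    by_cases h : (i : ℕ) < s <;> simp [head, tail, h, Real.zero_rpow hp0.ne']
  have hblock : schattenNorm p (X - U * M * Vᵀ) ^ p = ∑ i, head i ^ p + ∑ i, σ i ^ p := by
    rw [schattenNorm_rpow_of_svd hp0 hp1 hUG hVH (l := fun i => head i + σ i)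
      (fun i => add_nonneg (hhead0 i) (hσ0 i)), ← Finset.sum_add_distrib]
    · refine Finset.sum_congr rfl fun i _ => ?_
      by_cases h : (i : ℕ) < s
      · simp [hσq i h, Real.zero_rpow hp0.ne']
      · simp [head, h, Real.zero_rpow hp0.ne']
    · have hdecomp : Matrix.diagonal lam - M = G * Matrix.diagonal (fun i => head i + σ i) * Hᵀ := by
        rw [← Matrix.diagonal_add, Matrix.mul_add, Matrix.add_mul, ← hK,
          hfix head (fun i hi => if_neg hi), hsplit, add_sub_assoc]
      calc X - U * M * Vᵀ = U * (Matrix.diagonal lam - M) * Vᵀ := by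
            rw [hSVD, Matrix.mul_sub, Matrix.sub_mul]
        _ = _ := by rw [hdecomp, Matrix.transpose_mul]; simp only [Matrix.mul_assoc]
  have hneg : schattenNorm p (U * M * Vᵀ - U * Matrix.diagonal tail * Vᵀ) ^ p = ∑ i, σ i ^ p := by
    refine schattenNorm_rpow_of_svd hp0 hp1 (U := -(U * G)) (by simpa using hUG) hVH hσ0 ?_
    calc U * M * Vᵀ - U * Matrix.diagonal tail * Vᵀ = -(U * (Matrix.diagonal tail - M) * Vᵀ) := by
          rw [Matrix.mul_sub, Matrix.sub_mul, neg_sub]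
      _ = _ := by
          rw [hK, Matrix.transpose_mul]
          simp only [Matrix.mul_assoc, Matrix.neg_mul]
  have htailnorm : schattenNorm p (U * Matrix.diagonal tail * Vᵀ) ^ p = ∑ i, tail i ^ p :=
    schattenNorm_rpow_of_svd hp0 hp1 hU hV htail0 rfl
  have htri₁ := schattenNorm_rpow_add_le hp0 hp1 Xstar (Z - U * M * Vᵀ)
  rw [show Xstar + (Z - U * M * Vᵀ) = X - U * M * Vᵀ by rw [hZ]; abel, hblock] at htri₁
  have htri₂ := schattenNorm_rpow_add_le hp0 hp1 (U * M * Vᵀ - U * Matrix.diagonal tail * Vᵀ)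
    (U * Matrix.diagonal tail * Vᵀ)
  rw [sub_add_cancel, hneg, htailnorm] at htri₂
  have hmin' := Real.rpow_le_rpow (schattenNorm_nonneg p Xstar) hmin hp0.le
  rw [hXnorm, hlamsum] at hmin'
  have htailT : ∑ i, tail i ^ p = ∑ i ∈ Tᶜ, lam i ^ p := by
    rw [← Finset.sum_add_sum_compl T, Finset.sum_eq_zero, zero_add]
    · refine Finset.sum_congr rfl fun i hi => ?_
      rw [Finset.mem_compl, hmemT] at hi
      simp [tail, hi]
    · intro i hi
      rw [hmemT] at hi
      simp [tail, hi, Real.zero_rpow hp0.ne']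
  obtain ⟨μ, hμ, hμT, hμT'⟩ :
      ∃ μ : ℝ, 0 ≤ μ ∧ (∀ i ∈ T, μ ≤ lam i) ∧ ∀ i ∉ T, lam i ≤ μ := by
    rcases hsN.lt_or_eq with h | h
    · refine ⟨lam ⟨s, h⟩, hlam0 _, fun i hi => hlammono ?_, fun i hi => hlammono ?_⟩
      · rw [hmemT] at hi
        exact hi.le
      · rw [hmemT, not_lt] at hi
        exact hi
    · refine ⟨0, le_rfl, fun i _ => hlam0 i, fun i hi => absurd ((hmemT i).mpr ?_) hi⟩
      exact h ▸ i.isLt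
  have htailsum0 : 0 ≤ ∑ i, tail i ^ p :=
    Finset.sum_nonneg fun i _ => Real.rpow_nonneg (htail0 i) p
  have hrho : (∑ i, tail i ^ p) ^ (1 / p) ≤ rhoS p s X := by
    refine le_csInf ⟨_, 0, by simp, rfl⟩ ?_
    rintro _ ⟨Y, hY, rfl⟩
    have h := sum_compl_rpow_le_schattenNorm_sub hp0 hp1 (T := T) hU hV hlam0 hSVD
      (hTcard.symm ▸ hY) hμ hμT hμT'
    rw [← htailT] at h
    have h' := Real.rpow_le_rpow htailsum0 h (by positivity : 0 ≤ 1 / p)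
    rwa [← Real.rpow_mul (schattenNorm_nonneg _ _), mul_one_div_cancel hp0.ne',
      Real.rpow_one] at h'
  have hrho' := Real.rpow_le_rpow (Real.rpow_nonneg htailsum0 _) hrho hp0.le
  rw [← Real.rpow_mul htailsum0, one_div_mul_cancel hp0.ne', Real.rpow_one] at hrho'
  linarith
end
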